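/- arXiv:2601.06854 — 4 statements merged into one kernel-verified Lean document; each statement's English description precedes it below -/
import Mathlib

section
/- Let V, L, σ₀, F_z > 0, σ₁, σ₂ ≥ 0, χ₁, χ₂ ∈ {0,1}, ε ≥ 0, v ∈ ℝ with v² + ε > 0, μ(v) ≥ μ_min > 0, and set |v|_ε := √(v² + ε), sgn_ε(v) := v/|v|_ε, g := χ₁σ₁|v|_ε + μ(v), σ̄₀ := σ₀(1 − σ₁|v|_ε/g), σ̄₂ := σ₂ + σ₁μ(v)/g, p₀ := F_z/L. Let z(ξ) = sgn_ε(v)·(μ(v)/σ₀)·(1 − exp(−σ₀|v|_ε ξ/(V g))) be the stationary bristle deflection. Then the steady-state frictional force F := L∫₀¹ p₀ [σ₀ z(ξ) + σ₁(1−χ₂) V z′(ξ) + σ₂ v] dξ equals F = (v L p₀ V σ̄₀ μ(v) g / (σ₀² |v|_ε²))·[σ₀|v|_ε/(V g) + exp(−σ₀|v|_ε/(V g)) − 1] + L p₀ σ̄₂ v − χ₂ sgn_ε(v)·(L p₀ V σ₁ μ(v)/σ₀)·[1 − exp(−σ₀|v|_ε/(V g))]. -/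
open Real Set intervalIntegral

/-- Steady-state frictional force of the distributed FrBD model with a constant
pressure distribution `p(ξ) = p₀ = F_z/L`. -/
theorem stmt_1 (V L σ₀ F_z σ₁ σ₂ χ₁ χ₂ ε v μv μmin : ℝ)
    (hV : 0 < V) (hL : 0 < L) (hσ₀ : 0 < σ₀) (hFz : 0 < F_z)
    (hσ₁ : 0 ≤ σ₁) (hσ₂ : 0 ≤ σ₂)
    (hχ₁ : χ₁ = 0 ∨ χ₁ = 1) (hχ₂ : χ₂ = 0 ∨ χ₂ = 1) (hε : 0 ≤ ε)
    (hvε : 0 < v ^ 2 + ε) (hμmin : 0 < μmin) (hμ : μmin ≤ μv) :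
    let vabs : ℝ := Real.sqrt (v ^ 2 + ε)
    let sgnε : ℝ := v / vabs
    let g : ℝ := χ₁ * σ₁ * vabs + μv
    let σb₀ : ℝ := σ₀ * (1 - σ₁ * vabs / g)
    let σb₂ : ℝ := σ₂ + σ₁ * μv / g
    let p₀ : ℝ := F_z / L
    let zsol : ℝ → ℝ :=
      fun ξ => sgnε * (μv / σ₀) * (1 - Real.exp (-(σ₀ * vabs * ξ) / (V * g)))
    L * ∫ ξ in (0:ℝ)..1,
        p₀ * (σ₀ * zsol ξ + σ₁ * (1 - χ₂) * V * deriv zsol ξ + σ₂ * v)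
      = v * L * p₀ * V * σb₀ * μv * g / (σ₀ ^ 2 * vabs ^ 2) *
          (σ₀ * vabs / (V * g) + Real.exp (-(σ₀ * vabs) / (V * g)) - 1)
        + L * p₀ * σb₂ * v
        - χ₂ * sgnε * (L * p₀ * V * σ₁ * μv / σ₀) *
            (1 - Real.exp (-(σ₀ * vabs) / (V * g))) := by
  intro w s g σb₀ σb₂ p₀ z
  have hw : 0 < w := Real.sqrt_pos.mpr hvε
  have hg : 0 < g := by
    have h1 : 0 ≤ χ₁ * σ₁ * w := by
      rcases hχ₁ with h | h <;> rw [h] <;> simp <;> positivity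
    have : g = χ₁ * σ₁ * w + μv := rfl
    linarith
  have hE : ∀ x : ℝ, HasDerivAt (fun ξ : ℝ => Real.exp (-(σ₀ * w * ξ) / (V * g)))
      (Real.exp (-(σ₀ * w * x) / (V * g)) * (-(σ₀ * w) / (V * g))) x := by
    intro x
    have h := ((((hasDerivAt_id x).const_mul (σ₀ * w)).neg).div_const (V * g)).exp
    simpa using h
  have hz : ∀ x : ℝ, HasDerivAt z
      (s * (μv / σ₀) * (-(Real.exp (-(σ₀ * w * x) / (V * g)) * (-(σ₀ * w) / (V * g))))) x := by
    intro x
    exact ((hE x).const_sub 1).const_mul _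
  have hG : ∀ x : ℝ, HasDerivAt (fun ξ : ℝ =>
      p₀ * (σ₀ * (s * (μv / σ₀) * (ξ + V * g / (σ₀ * w) * Real.exp (-(σ₀ * w * ξ) / (V * g))))
        + σ₁ * (1 - χ₂) * V * z ξ + σ₂ * v * ξ))
      (p₀ * (σ₀ * z x + σ₁ * (1 - χ₂) * V * deriv z x + σ₂ * v)) x := by
    intro x
    have h := ((((((hasDerivAt_id x).add ((hE x).const_mul (V * g / (σ₀ * w)))).const_mul
      (s * (μv / σ₀))).const_mul σ₀).add ((hz x).const_mul (σ₁ * (1 - χ₂) * V))).add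
      ((hasDerivAt_id x).const_mul (σ₂ * v))).const_mul p₀
    refine h.congr_deriv ?_
    rw [(hz x).deriv]
    simp only [z]
    field_simp
    ring
  have hd : deriv z = fun x => 
      (s * (μv / σ₀) * (-(Real.exp (-(σ₀ * w * x) / (V * g)) * (-(σ₀ * w) / (V * g))))) :=
    funext fun x => (hz x).deriv
  have hc : Continuous fun x => 
      p₀ * (σ₀ * z x + σ₁ * (1 - χ₂) * V * deriv z x + σ₂ * v) := by
    rw [hd]
    simp only [z]
    fun_prop
  rw [integral_eq_sub_of_hasDerivAt (fun x _ => hG x) (hc.intervalIntegrable 0 1)]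
  simp only [z, σb₀, σb₂, s]
  clear_value p₀ g w
  simp only [mul_one, mul_zero, neg_zero, zero_div, Real.exp_zero]
  generalize Real.exp (-(σ₀ * w) / (V * g)) = E
  field_simp
  ring
end

section
/- Let A₁, G₁K₂, K₆ ∈ M₂(ℝ) be 2×2 real matrices and let Λ ∈ M₂(ℝ) be diagonal with strictly positive diagonal entries; let λ_min(Λ) > 0 denote its smallest diagonal entry. Define ω₀ := max{‖A₁‖ + ‖G₁K₂‖²/λ_min(Λ), ‖K₆‖²/λ_min(Λ)} (operator norms). Then for every y ∈ ℝ² and every continuously differentiable ζ : [0,1] → ℝ² with ζ(0) = 0, one has yᵀ(A₁y + G₁K₂ζ(1)) + ∫₀¹ ζ(ξ)ᵀ(−Λζ′(ξ) + K₆ζ(1)) dξ ≤ ω₀ (‖y‖² + ∫₀¹ ‖ζ(ξ)‖² dξ). -/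
open Real Set Matrix intervalIntegral

/-- The ℓ²-operator norm of a 2×2 real matrix. -/
noncomputable def opNorm2 (M : Matrix (Fin 2) (Fin 2) ℝ) : ℝ :=
  ‖Matrix.toEuclideanCLM (𝕜 := ℝ) M‖

lemma dot_self_eq (x : Fin 2 → ℝ) : x ⬝ᵥ x = ‖WithLp.toLp 2 x‖ ^ 2 := by
  rw [EuclideanSpace.norm_sq_eq]
  simp [dotProduct, sq]

lemma dot_mulVec_le (M : Matrix (Fin 2) (Fin 2) ℝ) (x v : Fin 2 → ℝ) :
    x ⬝ᵥ M.mulVec v ≤ opNorm2 M * ‖WithLp.toLp 2 x‖ * ‖WithLp.toLp 2 v‖ := by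
  have h1 : x ⬝ᵥ M.mulVec v
      = inner ℝ (WithLp.toLp 2 x) (Matrix.toEuclideanCLM (𝕜 := ℝ) M (WithLp.toLp 2 v)) := by
    simp [PiLp.inner_apply, dotProduct, Matrix.toEuclideanCLM_toLp, mul_comm]
  rw [h1]
  refine (real_inner_le_norm _ _).trans ?_
  have h2 := (Matrix.toEuclideanCLM (𝕜 := ℝ) M).le_opNorm (WithLp.toLp 2 v)
  have h3 := mul_le_mul_of_nonneg_left h2 (norm_nonneg (WithLp.toLp 2 x))
  unfold opNorm2
  linarith

lemma dot_young (M : Matrix (Fin 2) (Fin 2) ℝ) (x v : Fin 2 → ℝ) (l : ℝ) (hl : 0 < l) :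
    x ⬝ᵥ M.mulVec v ≤ opNorm2 M ^ 2 / l * (x ⬝ᵥ x) + l / 4 * (v ⬝ᵥ v) := by
  refine (dot_mulVec_le M x v).trans ?_
  rw [dot_self_eq, dot_self_eq]
  set a := opNorm2 M
  set p := ‖WithLp.toLp 2 x‖
  set q := ‖WithLp.toLp 2 v‖
  have h : a ^ 2 / l * p ^ 2 + l / 4 * q ^ 2 - a * p * q = (a * p - l * q / 2) ^ 2 / l := by
    field_simp
    ring
  have : 0 ≤ (a * p - l * q / 2) ^ 2 / l := by positivity
  linarith

/-- Quasi-dissipativity of the transport operator 𝒜₀ of the single-track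
ODE-PDE system: `⟨𝒜₀(y,ζ),(y,ζ)⟩ ≤ ω₀‖(y,ζ)‖²` on ℝ² × L²((0,1);ℝ²). -/
theorem stmt_5 (A B K₆ : Matrix (Fin 2) (Fin 2) ℝ) (d : Fin 2 → ℝ)
    (hd : ∀ i, 0 < d i) :
    let Λ : Matrix (Fin 2) (Fin 2) ℝ := Matrix.diagonal d
    let lmin : ℝ := min (d 0) (d 1)
    let ω₀ : ℝ := max (opNorm2 A + opNorm2 B ^ 2 / lmin) (opNorm2 K₆ ^ 2 / lmin)
    ∀ (y : Fin 2 → ℝ) (ζ ζ' : ℝ → Fin 2 → ℝ),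
      (∀ ξ ∈ Icc (0:ℝ) 1, HasDerivWithinAt ζ (ζ' ξ) (Icc 0 1) ξ) →
      ContinuousOn ζ' (Icc 0 1) → ζ 0 = 0 →
      y ⬝ᵥ (A.mulVec y + B.mulVec (ζ 1))
          + (∫ ξ in (0:ℝ)..1, ζ ξ ⬝ᵥ (-(Λ.mulVec (ζ' ξ)) + K₆.mulVec (ζ 1)))
        ≤ ω₀ * (y ⬝ᵥ y + ∫ ξ in (0:ℝ)..1, ζ ξ ⬝ᵥ ζ ξ) := by
  intro Λ lmin ω₀ y ζ ζ' hder hcont h0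
  have hl : 0 < lmin := lt_min (hd 0) (hd 1)
  have hA : y ⬝ᵥ A.mulVec y ≤ opNorm2 A * (y ⬝ᵥ y) := by
    have := dot_mulVec_le A y y
    rw [dot_self_eq]
    linarith
  have hB := dot_young B y (ζ 1) lmin hl
  have hζ : ContinuousOn ζ (Icc 0 1) := fun ξ hξ => (hder ξ hξ).continuousWithinAt
  have hζi : ∀ i, ContinuousOn (fun ξ => ζ ξ i) (Icc 0 1) := fun i => continuousOn_pi.1 hζ i
  have hζi' : ∀ i, ContinuousOn (fun ξ => ζ' ξ i) (Icc 0 1) := fun i => continuousOn_pi.1 hcont i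
  have c0 := hζi 0
  have c1 := hζi 1
  have c0' := hζi' 0
  have c1' := hζi' 1
  have hii : ∀ f : ℝ → ℝ, ContinuousOn f (Icc 0 1) → IntervalIntegrable f MeasureTheory.volume 0 1 :=
    fun f hf => ContinuousOn.intervalIntegrable (by rwa [uIcc_of_le zero_le_one])
  have hF : (∫ ξ in (0:ℝ)..1, -(d 0 * ζ ξ 0 * ζ' ξ 0 + d 1 * ζ ξ 1 * ζ' ξ 1))
      = -(d 0 * ζ 1 0 ^ 2 + d 1 * ζ 1 1 ^ 2) / 2 := by
    rw [integral_eq_sub_of_hasDerivAt_of_le (f := fun ξ => -(d 0 * ζ ξ 0 ^ 2 + d 1 * ζ ξ 1 ^ 2) / 2)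
      zero_le_one (by fun_prop) _ (hii _ (by fun_prop))]
    · simp [h0]
    · intro ξ hξ
      have h := (hder ξ (Ioo_subset_Icc_self hξ)).hasDerivAt (Icc_mem_nhds hξ.1 hξ.2)
      have e := hasDerivAt_pi.1 h
      have := ((((e 0).pow 2).const_mul (d 0)).add (((e 1).pow 2).const_mul (d 1))).neg.div_const 2
      refine HasDerivAt.congr_deriv this ?_
      push_cast
      ring
  have hI : (∫ ξ in (0:ℝ)..1, ζ ξ ⬝ᵥ (-(Λ.mulVec (ζ' ξ)) + K₆.mulVec (ζ 1)))
      ≤ ∫ ξ in (0:ℝ)..1, (-(d 0 * ζ ξ 0 * ζ' ξ 0 + d 1 * ζ ξ 1 * ζ' ξ 1)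
        + (opNorm2 K₆ ^ 2 / lmin * (ζ ξ ⬝ᵥ ζ ξ) + lmin / 4 * (ζ 1 ⬝ᵥ ζ 1))) := by
    apply integral_mono_on zero_le_one
    · apply hii
      simp only [dotProduct, Fin.sum_univ_two, Pi.add_apply, Pi.neg_apply, Λ, mulVec_diagonal]
      fun_prop
    · apply hii
      simp only [dotProduct, Fin.sum_univ_two]
      fun_prop
    · intro ξ _
      have := dot_young K₆ (ζ ξ) (ζ 1) lmin hl
      have e : ζ ξ ⬝ᵥ (-(Λ.mulVec (ζ' ξ)) + K₆.mulVec (ζ 1))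
          = -(d 0 * ζ ξ 0 * ζ' ξ 0 + d 1 * ζ ξ 1 * ζ' ξ 1) + ζ ξ ⬝ᵥ K₆.mulVec (ζ 1) := by
        rw [dotProduct_add]
        congr 1
        simp only [dotProduct, Fin.sum_univ_two, Pi.neg_apply, Λ, mulVec_diagonal]
        ring
      linarith
  have cS : ContinuousOn (fun ξ => ζ ξ ⬝ᵥ ζ ξ) (Icc 0 1) := by
    simp only [dotProduct, Fin.sum_univ_two]
    fun_prop
  rw [integral_add (hii _ (by fun_prop)) (hii _ (by fun_prop)),
    integral_add (hii _ (by fun_prop)) (hii _ (by fun_prop)), hF, integral_const_mul,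
    integral_const] at hI
  have hS : 0 ≤ ∫ ξ in (0:ℝ)..1, ζ ξ ⬝ᵥ ζ ξ :=
    integral_nonneg zero_le_one fun ξ _ => by rw [dot_self_eq]; positivity
  have hY : 0 ≤ y ⬝ᵥ y := by rw [dot_self_eq]; positivity
  have m1 := mul_le_mul_of_nonneg_right (le_max_left _ _ : opNorm2 A + opNorm2 B ^ 2 / lmin ≤ ω₀) hY
  have m2 := mul_le_mul_of_nonneg_right (le_max_right _ _ : opNorm2 K₆ ^ 2 / lmin ≤ ω₀) hS
  have z : ζ 1 ⬝ᵥ ζ 1 = ζ 1 0 ^ 2 + ζ 1 1 ^ 2 := by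
    simp only [dotProduct, Fin.sum_univ_two]
    ring
  have l0 := mul_le_mul_of_nonneg_right (min_le_left _ _ : lmin ≤ d 0) (sq_nonneg (ζ 1 0))
  have l1 := mul_le_mul_of_nonneg_right (min_le_right _ _ : lmin ≤ d 1) (sq_nonneg (ζ 1 1))
  rw [z] at hB hI
  rw [dotProduct_add, mul_add]
  simp only [sub_zero, smul_eq_mul, one_mul] at hI
  rw [add_mul] at m1
  linarith
end

section
/- Let A₁, G₁K₂, K₆ ∈ M₂(ℝ) be 2×2 real matrices and let Λ ∈ M₂(ℝ) be diagonal with strictly positive diagonal entries; let λ_min(Λ) > 0 denote its smallest diagonal entry and define ω₀ := max{‖A₁‖ + ‖G₁K₂‖²/λ_min(Λ), ‖K₆‖²/λ_min(Λ)}. Then for every y ∈ ℝ² and every continuously differentiable ζ : [0,1] → ℝ² satisfying the adjoint boundary condition Λζ(1) = (G₁K₂)ᵀy + K₆ᵀ∫₀¹ ζ(ξ) dξ, one has yᵀA₁ᵀy + ∫₀¹ ζ(ξ)ᵀ Λ ζ′(ξ) dξ ≤ ω₀ (‖y‖² + ∫₀¹ ‖ζ(ξ)‖² dξ). -/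
open Real Set Matrix intervalIntegral

lemma opNorm2_nonneg (M : Matrix (Fin 2) (Fin 2) ℝ) : 0 ≤ opNorm2 M := norm_nonneg _

lemma opNorm2_transpose (M : Matrix (Fin 2) (Fin 2) ℝ) : opNorm2 Mᵀ = opNorm2 M := by
  unfold opNorm2
  have h : Mᵀ = star M := by
    ext i j; simp [Matrix.star_apply]
  rw [h, map_star, ContinuousLinearMap.star_eq_adjoint]
  exact LinearIsometryEquiv.norm_map _ _

lemma normsq_toLp (v : Fin 2 → ℝ) : ‖WithLp.toLp 2 v‖ ^ 2 = v ⬝ᵥ v := by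
  rw [EuclideanSpace.norm_sq_eq]
  simp [dotProduct, Fin.sum_univ_two, sq]

lemma norm_mulVec_le (M : Matrix (Fin 2) (Fin 2) ℝ) (v : Fin 2 → ℝ) :
    ‖WithLp.toLp 2 (M.mulVec v)‖ ≤ opNorm2 M * ‖WithLp.toLp 2 v‖ := by
  have h := (Matrix.toEuclideanCLM (𝕜 := ℝ) M).le_opNorm (WithLp.toLp 2 v)
  rw [Matrix.toEuclideanCLM_toLp] at h
  exact h

lemma mulVec_sq_le (M : Matrix (Fin 2) (Fin 2) ℝ) (v : Fin 2 → ℝ) :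
    Mᵀ.mulVec v ⬝ᵥ Mᵀ.mulVec v ≤ opNorm2 M ^ 2 * (v ⬝ᵥ v) := by
  have h := norm_mulVec_le Mᵀ v
  rw [opNorm2_transpose] at h
  rw [← normsq_toLp, ← normsq_toLp, ← mul_pow]
  exact pow_le_pow_left₀ (norm_nonneg _) h 2

lemma quad_le (M : Matrix (Fin 2) (Fin 2) ℝ) (v : Fin 2 → ℝ) :
    v ⬝ᵥ Mᵀ.mulVec v ≤ opNorm2 M * (v ⬝ᵥ v) := by
  have h := norm_mulVec_le Mᵀ v
  rw [opNorm2_transpose] at h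
  have h2 := real_inner_le_norm (WithLp.toLp 2 (Mᵀ.mulVec v)) (WithLp.toLp 2 v)
  have h3 : inner ℝ (WithLp.toLp 2 (Mᵀ.mulVec v)) (WithLp.toLp 2 v) = v ⬝ᵥ Mᵀ.mulVec v := by
    simp [PiLp.inner_apply, dotProduct, Fin.sum_univ_two]
  rw [h3] at h2
  rw [← normsq_toLp]
  nlinarith [norm_nonneg (WithLp.toLp 2 v)]

lemma sq_integral_le (f : ℝ → ℝ) (hf : ContinuousOn f (Icc 0 1)) :
    (∫ x in (0:ℝ)..1, f x) ^ 2 ≤ ∫ x in (0:ℝ)..1, f x * f x := by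
  have hu : uIcc (0:ℝ) 1 = Icc 0 1 := uIcc_of_le zero_le_one
  set m := ∫ x in (0:ℝ)..1, f x with hm
  have i1 : IntervalIntegrable f MeasureTheory.volume 0 1 :=
    ContinuousOn.intervalIntegrable (by rwa [hu])
  have i2 : IntervalIntegrable (fun x => f x * f x) MeasureTheory.volume 0 1 :=
    ContinuousOn.intervalIntegrable (by rw [hu]; exact hf.mul hf)
  have h0 : 0 ≤ ∫ x in (0:ℝ)..1, (f x - m) ^ 2 :=
    intervalIntegral.integral_nonneg zero_le_one (fun x _ => sq_nonneg _)
  have h1 : (∫ x in (0:ℝ)..1, (f x - m) ^ 2)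
      = (∫ x in (0:ℝ)..1, f x * f x) - 2 * m * m + m ^ 2 := by
    have : (fun x => (f x - m) ^ 2) = fun x => (f x * f x - 2 * m * f x) + m ^ 2 := by
      ext x; ring
    rw [this, intervalIntegral.integral_add (i2.sub (i1.const_mul _)) (by simp),
      intervalIntegral.integral_sub i2 (i1.const_mul _),
      intervalIntegral.integral_const_mul, ← hm]
    simp
  nlinarith

lemma ftc_half (f f' : ℝ → ℝ)
    (hf : ∀ x ∈ Icc (0:ℝ) 1, HasDerivWithinAt f (f' x) (Icc 0 1) x)
    (hf' : ContinuousOn f' (Icc 0 1)) :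
    (∫ x in (0:ℝ)..1, f x * f' x) = (f 1 ^ 2 - f 0 ^ 2) / 2 := by
  have hu : uIcc (0:ℝ) 1 = Icc 0 1 := uIcc_of_le zero_le_one
  have hc : ContinuousOn f (Icc 0 1) := fun x hx => (hf x hx).continuousWithinAt
  have := intervalIntegral.integral_eq_sub_of_hasDerivAt_of_le (a := 0) (b := 1)
    (f := fun x => f x ^ 2 / 2) (f' := fun x => f x * f' x) zero_le_one
    ((hc.pow 2).div_const 2)
    (fun x hx => by
      have h := (hf x (Ioo_subset_Icc_self hx)).hasDerivAt (Icc_mem_nhds hx.1 hx.2)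
      have h2 := (h.pow 2).div_const 2
      exact h2.congr_deriv (by push_cast; ring))
    (ContinuousOn.intervalIntegrable (by rw [hu]; exact hc.mul hf'))
  rw [this]; ring

/-- Quasi-dissipativity of the adjoint 𝒜₀* of the transport operator of the
single-track ODE-PDE system, on its domain characterised by the adjoint
boundary condition `Λζ(1) = (G₁K₂)ᵀy + K₆ᵀ∫₀¹ζ`. -/
theorem stmt_6 (A B K₆ : Matrix (Fin 2) (Fin 2) ℝ) (d : Fin 2 → ℝ)
    (hd : ∀ i, 0 < d i) :
    let Λ : Matrix (Fin 2) (Fin 2) ℝ := Matrix.diagonal d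
    let lmin : ℝ := min (d 0) (d 1)
    let ω₀ : ℝ := max (opNorm2 A + opNorm2 B ^ 2 / lmin) (opNorm2 K₆ ^ 2 / lmin)
    ∀ (y : Fin 2 → ℝ) (ζ ζ' : ℝ → Fin 2 → ℝ),
      (∀ ξ ∈ Icc (0:ℝ) 1, HasDerivWithinAt ζ (ζ' ξ) (Icc 0 1) ξ) →
      ContinuousOn ζ' (Icc 0 1) →
      Λ.mulVec (ζ 1) = Bᵀ.mulVec y + K₆ᵀ.mulVec (∫ ξ in (0:ℝ)..1, ζ ξ) →
      y ⬝ᵥ Aᵀ.mulVec y + (∫ ξ in (0:ℝ)..1, ζ ξ ⬝ᵥ Λ.mulVec (ζ' ξ))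
        ≤ ω₀ * (y ⬝ᵥ y + ∫ ξ in (0:ℝ)..1, ζ ξ ⬝ᵥ ζ ξ) := by
  intro Λ lmin ω₀ y ζ ζ' hζ hζ' hbc
  have hu : uIcc (0:ℝ) 1 = Icc 0 1 := uIcc_of_le zero_le_one
  have hl : 0 < lmin := lt_min (hd 0) (hd 1)
  have hci : ∀ i, ∀ ξ ∈ Icc (0:ℝ) 1,
      HasDerivWithinAt (fun t => ζ t i) (ζ' ξ i) (Icc 0 1) ξ :=
    fun i ξ hξ => (hasDerivWithinAt_pi.1 (hζ ξ hξ)) i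
  have hc : ContinuousOn ζ (Icc 0 1) := fun x hx => (hζ x hx).continuousWithinAt
  have hcc : ∀ i, ContinuousOn (fun t => ζ t i) (Icc 0 1) := fun i => continuousOn_pi.1 hc i
  have hcc' : ∀ i, ContinuousOn (fun t => ζ' t i) (Icc 0 1) := fun i => continuousOn_pi.1 hζ' i
  set m : Fin 2 → ℝ := ∫ ξ in (0:ℝ)..1, ζ ξ with hm
  have hmi : ∀ i, m i = ∫ ξ in (0:ℝ)..1, ζ ξ i := by
    intro i
    have := (ContinuousLinearMap.proj (R := ℝ) (φ := fun _ : Fin 2 => ℝ) i).intervalIntegral_comp_comm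
      (ContinuousOn.intervalIntegrable (μ := MeasureTheory.volume) (by rw [hu]; exact hc))
    exact this.symm
  have iz : ∀ i, IntervalIntegrable (fun t => ζ t i * ζ t i) MeasureTheory.volume 0 1 :=
    fun i => ContinuousOn.intervalIntegrable (by rw [hu]; exact (hcc i).mul (hcc i))
  have iz' : ∀ i, IntervalIntegrable (fun t => ζ t i * ζ' t i) MeasureTheory.volume 0 1 :=
    fun i => ContinuousOn.intervalIntegrable (by rw [hu]; exact (hcc i).mul (hcc' i))
  have e1 : (∫ ξ in (0:ℝ)..1, ζ ξ ⬝ᵥ ζ ξ)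
      = (∫ ξ in (0:ℝ)..1, ζ ξ 0 * ζ ξ 0) + ∫ ξ in (0:ℝ)..1, ζ ξ 1 * ζ ξ 1 := by
    rw [← intervalIntegral.integral_add (iz 0) (iz 1)]
    simp [dotProduct, Fin.sum_univ_two]
  have e2 : (∫ ξ in (0:ℝ)..1, ζ ξ ⬝ᵥ Λ.mulVec (ζ' ξ))
      = d 0 * ((ζ 1 0 ^ 2 - ζ 0 0 ^ 2) / 2) + d 1 * ((ζ 1 1 ^ 2 - ζ 0 1 ^ 2) / 2) := by
    rw [← ftc_half _ _ (hci 0) (hcc' 0), ← ftc_half _ _ (hci 1) (hcc' 1),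
      ← intervalIntegral.integral_const_mul, ← intervalIntegral.integral_const_mul,
      ← intervalIntegral.integral_add ((iz' 0).const_mul _) ((iz' 1).const_mul _)]
    congr 1
    ext ξ
    simp only [Λ, dotProduct, Fin.sum_univ_two, Matrix.mulVec_diagonal]
    ring
  have hmm : m ⬝ᵥ m ≤ ∫ ξ in (0:ℝ)..1, ζ ξ ⬝ᵥ ζ ξ := by
    rw [e1]
    have h0 := sq_integral_le _ (hcc 0)
    have h1 := sq_integral_le _ (hcc 1)
    rw [← hmi] at h0 h1
    simp only [dotProduct, Fin.sum_univ_two]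
    nlinarith
  have hB := mulVec_sq_le B y
  have hK := mulVec_sq_le K₆ m
  have hA := quad_le A y
  set p := Bᵀ.mulVec y
  set q := K₆ᵀ.mulVec m
  have b : ∀ i, d i * ζ 1 i = p i + q i := by
    intro i
    have := congrFun hbc i
    simpa [Λ, Matrix.mulVec_diagonal] using this
  have hli : ∀ i, lmin ≤ d i := by
    intro i; fin_cases i
    · exact min_le_left _ _
    · exact min_le_right _ _
  have key : ∀ i, d i * (ζ 1 i ^ 2 / 2) ≤ (p i * p i + q i * q i) / lmin := by
    intro i
    rw [le_div_iff₀ hl]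
    have h1 : d i * (ζ 1 i ^ 2 / 2) * lmin ≤ d i * (ζ 1 i ^ 2 / 2) * d i :=
      mul_le_mul_of_nonneg_left (hli i) (mul_nonneg (hd i).le (by positivity))
    have h2 : d i * (ζ 1 i ^ 2 / 2) * d i = (p i + q i) ^ 2 / 2 := by rw [← b i]; ring
    nlinarith [sq_nonneg (p i - q i)]
  have e3 : (∫ ξ in (0:ℝ)..1, ζ ξ ⬝ᵥ Λ.mulVec (ζ' ξ)) ≤ (p ⬝ᵥ p) / lmin + (q ⬝ᵥ q) / lmin := by
    rw [e2]
    have k0 := key 0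
    have k1 := key 1
    have z0 := mul_nonneg (hd 0).le (sq_nonneg (ζ 0 0))
    have z1 := mul_nonneg (hd 1).le (sq_nonneg (ζ 0 1))
    have : (p ⬝ᵥ p) / lmin + (q ⬝ᵥ q) / lmin
      = (p 0 * p 0 + q 0 * q 0) / lmin + (p 1 * p 1 + q 1 * q 1) / lmin := by
      simp only [dotProduct, Fin.sum_univ_two]; ring
    rw [this]
    linarith
  have hP : (p ⬝ᵥ p) / lmin ≤ opNorm2 B ^ 2 / lmin * (y ⬝ᵥ y) := by
    rw [div_mul_eq_mul_div]; exact div_le_div_of_nonneg_right hB hl.le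
  have hQ : (q ⬝ᵥ q) / lmin ≤ opNorm2 K₆ ^ 2 / lmin * (m ⬝ᵥ m) := by
    rw [div_mul_eq_mul_div]; exact div_le_div_of_nonneg_right hK hl.le
  have hyy : 0 ≤ y ⬝ᵥ y := by rw [← normsq_toLp]; positivity
  have hmm0 : 0 ≤ m ⬝ᵥ m := by rw [← normsq_toLp]; positivity
  have w1 := mul_le_mul_of_nonneg_right
    (le_max_left (opNorm2 A + opNorm2 B ^ 2 / lmin) (opNorm2 K₆ ^ 2 / lmin)) hyy
  have w2 := mul_le_mul_of_nonneg_right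
    (le_max_right (opNorm2 A + opNorm2 B ^ 2 / lmin) (opNorm2 K₆ ^ 2 / lmin)) (hmm0.trans hmm)
  have w3 := mul_le_mul_of_nonneg_left hmm
    (show 0 ≤ opNorm2 K₆ ^ 2 / lmin from div_nonneg (sq_nonneg _) hl.le)
  change _ ≤ max (opNorm2 A + opNorm2 B ^ 2 / lmin) (opNorm2 K₆ ^ 2 / lmin) * _
  rw [mul_add]
  linarith
end

section
/- Let v_x, L, σ₀ > 0, let v ∈ ℝ and ε ≥ 0 with v² + ε > 0, let μ(v) ≥ μ_min > 0, set |v|_ε := √(v² + ε), and let φ, ψ ∈ (0,1) satisfy φ + ψ = 1. Let p̄ : [0,1] → ℝ be continuously differentiable and nonnegative with ∫₀¹ p̄(ξ) dξ = 1. Suppose z : [0,1] → ℝ is continuously differentiable with z(0) = 0 and satisfies the rigid-carcass steady-state equation (v_x/L) z′(ξ) = −(σ₀|v|_ε/μ(v)) z(ξ) + 2v for all ξ ∈ [0,1]. Then z also satisfies the flexible-carcass steady-state equation: for all ξ ∈ [0,1], (v_x/L) z′(ξ) = −(σ₀|v|_ε/μ(v))·(z(ξ) − ψ∫₀¹ p̄(ξ′)z(ξ′)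 dξ′) + (v_x ψ/L)·(p̄(1)z(1) − ∫₀¹ p̄′(ξ′)z(ξ′) dξ′) + 2φv. -/
open Real Set intervalIntegral

/-- The steady-state solution of the rigid-carcass tyre equation also solves
the nonlocal flexible-carcass steady-state equation. -/
theorem stmt_9 (v_x L σ₀ v ε μv μmin φ ψ : ℝ)
    (hvx : 0 < v_x) (hL : 0 < L) (hσ₀ : 0 < σ₀) (hε : 0 ≤ ε)
    (hvε : 0 < v ^ 2 + ε) (hμmin : 0 < μmin) (hμ : μmin ≤ μv)
    (hφ : φ ∈ Ioo (0:ℝ) 1) (hψ : ψ ∈ Ioo (0:ℝ) 1) (hφψ : φ + ψ = 1)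
    (pbar pbar' z z' : ℝ → ℝ)
    (hpbar : ∀ ξ ∈ Icc (0:ℝ) 1, HasDerivWithinAt pbar (pbar' ξ) (Icc 0 1) ξ)
    (hpbar'c : ContinuousOn pbar' (Icc 0 1))
    (hpbarnn : ∀ ξ ∈ Icc (0:ℝ) 1, 0 ≤ pbar ξ)
    (hpint : (∫ ξ in (0:ℝ)..1, pbar ξ) = 1)
    (hz : ∀ ξ ∈ Icc (0:ℝ) 1, HasDerivWithinAt z (z' ξ) (Icc 0 1) ξ)
    (hz'c : ContinuousOn z' (Icc 0 1))
    (hz0 : z 0 = 0)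
    (hrigid : ∀ ξ ∈ Icc (0:ℝ) 1,
      (v_x / L) * z' ξ = -(σ₀ * Real.sqrt (v ^ 2 + ε) / μv) * z ξ + 2 * v) :
    ∀ ξ ∈ Icc (0:ℝ) 1,
      (v_x / L) * z' ξ
        = -(σ₀ * Real.sqrt (v ^ 2 + ε) / μv) *
            (z ξ - ψ * ∫ ξ' in (0:ℝ)..1, pbar ξ' * z ξ')
          + (v_x * ψ / L) * (pbar 1 * z 1 - ∫ ξ' in (0:ℝ)..1, pbar' ξ' * z ξ')
          + 2 * φ * v := by
  have hu : uIcc (0:ℝ) 1 = Icc 0 1 := uIcc_of_le zero_le_one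
  have hpc : ContinuousOn pbar (Icc 0 1) := fun x hx => (hpbar x hx).continuousWithinAt
  have hzc : ContinuousOn z (Icc 0 1) := fun x hx => (hz x hx).continuousWithinAt
  have hparts : (∫ ξ in (0:ℝ)..1, pbar ξ * z' ξ)
      = pbar 1 * z 1 - pbar 0 * z 0 - ∫ ξ in (0:ℝ)..1, pbar' ξ * z ξ := by
    apply integral_mul_deriv_eq_deriv_mul_of_hasDerivWithinAt
    · rw [hu]; exact hpbar
    · rw [hu]; exact hz
    · apply ContinuousOn.intervalIntegrable; rw [hu]; exact hpbar'c
    · apply ContinuousOn.intervalIntegrable; rw [hu]; exact hz'c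
  rw [hz0, mul_zero, sub_zero] at hparts
  intro ξ hξ
  rw [← hparts, hrigid ξ hξ]
  generalize σ₀ * Real.sqrt (v ^ 2 + ε) / μv = k at *
  have hI : (v_x / L) * (∫ ξ in (0:ℝ)..1, pbar ξ * z' ξ)
      = -k * (∫ ξ in (0:ℝ)..1, pbar ξ * z ξ) + 2 * v := by
    have i1 : IntervalIntegrable (fun x => -k * (pbar x * z x)) MeasureTheory.volume 0 1 := by
      apply ContinuousOn.intervalIntegrable; rw [hu]
      exact continuousOn_const.mul (hpc.mul hzc)
    have i2 : IntervalIntegrable (fun x => 2 * v * pbar x) MeasureTheory.volume 0 1 := by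
      apply ContinuousOn.intervalIntegrable; rw [hu]
      exact continuousOn_const.mul hpc
    have e : (∫ x in (0:ℝ)..1, (v_x / L) * (pbar x * z' x))
        = ∫ x in (0:ℝ)..1, (-k * (pbar x * z x) + 2 * v * pbar x) := by
      apply integral_congr
      intro x hx
      rw [hu] at hx
      have := hrigid x hx
      linear_combination pbar x * this
    rw [integral_add i1 i2, integral_const_mul, integral_const_mul, integral_const_mul,
      hpint, mul_one] at e
    exact e
  linear_combination (-ψ) * hI - 2 * v * hφψ
end
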